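/- Let d ≥ 3 and 0 ≤ m ≤ d. The diagonal of the Green's function of the simple random walk on U_m = ℕ₀^m × ℤ^{d−m} attains its supremum at the origin: sup_{x ∈ U_m} G_m(x, x) = G_m(0, 0). -/

import Mathlib

open scoped ENNReal
open Filter

noncomputable section

variable {V : Type*}

/-- Total conductance (weight) `π(x) = Σ_y c(x,y)` at a vertex `x`. -/
def piW (c : V → V → ℝ≥0∞) (x : V) : ℝ≥0∞ := ∑' y, c x y

/-- One-step transition probability `c(x,y)/π(x)` of the random walk with conductances `c`. -/
def step (c : V → V → ℝ≥0∞) (x y : V) : ℝ≥0∞ := c x y / piW c x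

/-- `n`-step transition probability of the random walk with conductances `c`. -/
def stepN [DecidableEq V] (c : V → V → ℝ≥0∞) : ℕ → V → V → ℝ≥0∞
  | 0, x, y => if x = y then 1 else 0
  | n + 1, x, y => ∑' z, stepN c n x z * step c z y

/-- Green's function `G(x,y) = π(y)⁻¹ Σ_n p_n(x,y)` of the walk with conductances `c`. -/
def green [DecidableEq V] (c : V → V → ℝ≥0∞) (x y : V) : ℝ≥0∞ :=
  (piW c y)⁻¹ * ∑' n, stepN c n x y

/-- Nearest-neighbour adjacency on `ℤ^d`. -/
def latAdj {d : ℕ} (x y : Fin d → ℤ) : Prop := (∑ i, (x i - y i).natAbs) = 1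

instance {d : ℕ} (x y : Fin d → ℤ) : Decidable (latAdj x y) := by
  unfold latAdj; infer_instance

/-- Unit conductances on `ℤ^d`. -/
def cZ (d : ℕ) (x y : Fin d → ℤ) : ℝ≥0∞ := if latAdj x y then 1 else 0

/-- Green's function of the simple random walk on `ℤ^d`. -/
def g (d : ℕ) : (Fin d → ℤ) → (Fin d → ℤ) → ℝ≥0∞ := green (cZ d)

/-- Membership in `U_m = ℕ₀^m × ℤ^{d-m}`: the first `m` coordinates are nonnegative. -/
def memU (m : ℕ) {d : ℕ} (x : Fin d → ℤ) : Prop := ∀ i : Fin d, (i : ℕ) < m → 0 ≤ x i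

instance (m : ℕ) {d : ℕ} (x : Fin d → ℤ) : Decidable (memU m x) := by
  unfold memU; infer_instance

/-- Unit conductances on the subgraph `U_m` of `ℤ^d`. -/
def cU (d m : ℕ) (x y : Fin d → ℤ) : ℝ≥0∞ :=
  if memU m x ∧ memU m y ∧ latAdj x y then 1 else 0

/-- Green's function `G_m` of the simple random walk on `U_m = ℕ₀^m × ℤ^{d-m}`. -/
def Gm (d m : ℕ) : (Fin d → ℤ) → (Fin d → ℤ) → ℝ≥0∞ := green (cU d m)

/-- Reflection in the first coordinate: `ȳ = (-y₁, y₂, …, y_d)`. -/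
def reflFirst {d : ℕ} (y : Fin d → ℤ) : Fin d → ℤ := fun i => if (i : ℕ) = 0 then -y i else y i

/-- The first standard basis vector of `ℤ^d`. -/
def e1 (d : ℕ) : Fin d → ℤ := fun i => if (i : ℕ) = 0 then 1 else 0


/-- The lattice point `y + e_j`. -/
def moveUp {d : ℕ} (j : Fin d) (y : Fin d → ℤ) : Fin d → ℤ := y + Pi.single j 1

/-- The lattice point `y - e_j`, or `y` itself if that step would leave `U_m` through the face
`y_j = 0`. -/
def moveDown (m : ℕ) {d : ℕ} (j : Fin d) (y : Fin d → ℤ) : Fin d → ℤ :=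
  if (j : ℕ) < m ∧ y j ≤ 0 then y else y - Pi.single j 1

/-- Number of `n`-step paths from `x` to `y` of the walk on `U_m` that stays put whenever a step
would leave `U_m`. -/
def lazyCount (m : ℕ) {d : ℕ} : ℕ → (Fin d → ℤ) → (Fin d → ℤ) → ℝ≥0∞
  | 0, x, y => if x = y then 1 else 0
  | n + 1, x, y => ∑ j, (lazyCount m n x (moveUp j y) + lazyCount m n x (moveDown m j y))

/-- Green's function of the lazy walk on `U_m`, normalized by the total rate `2d`. -/
def lazyGreen (m : ℕ) {d : ℕ} (x y : Fin d → ℤ) : ℝ≥0∞ :=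
  ∑' n, ((2 * d : ℝ≥0∞)⁻¹) ^ (n + 1) * lazyCount m n x y

/-- Number of steps from `y` that would leave `U_m`. -/
def blockedCount (m : ℕ) {d : ℕ} (y : Fin d → ℤ) : ℝ≥0∞ :=
  ∑ j : Fin d, if (j : ℕ) < m ∧ y j ≤ 0 then 1 else 0

section Moves

variable {m d : ℕ} {x y : Fin d → ℤ}

lemma memU_moveUp (hy : memU m y) (j : Fin d) : memU m (moveUp j y) := by
  intro i hi
  have := hy i hi
  rcases eq_or_ne i j with rfl | h
  · simp [moveUp]; omega
  · simp [moveUp, h, this]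

lemma memU_moveDown (hy : memU m y) (j : Fin d) : memU m (moveDown m j y) := by
  unfold moveDown
  split_ifs with hb
  · exact hy
  intro i hi
  have := hy i hi
  rcases eq_or_ne i j with rfl | h
  · simp; omega
  · simp [h, this]

lemma moveUp_comm (i j : Fin d) (y : Fin d → ℤ) :
    moveUp j (moveUp i y) = moveUp i (moveUp j y) := by
  simp only [moveUp]; abel

lemma moveDown_moveUp_of_ne {i j : Fin d} (h : j ≠ i) (y : Fin d → ℤ) :
    moveDown m j (moveUp i y) = moveUp i (moveDown m j y) := by
  simp only [moveDown, moveUp, Pi.add_apply, Pi.single_eq_of_ne h, add_zero]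
  split_ifs
  · rfl
  · abel

lemma moveDown_moveUp_self (hy : memU m y) (i : Fin d) : moveDown m i (moveUp i y) = y := by
  have : ¬ ((i : ℕ) < m ∧ moveUp i y i ≤ 0) := by
    rintro ⟨hi, h⟩
    have := hy i hi
    simp [moveUp] at h
    omega
  rw [moveDown, if_neg this, moveUp, add_sub_cancel_right]

lemma moveDown_of_blocked {i : Fin d} (hi : (i : ℕ) < m) (h : y i ≤ 0) :
    moveDown m i y = y := if_pos ⟨hi, h⟩

lemma moveUp_moveDown_self {i : Fin d} (h : ¬ ((i : ℕ) < m ∧ y i ≤ 0)) :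
    moveUp i (moveDown m i y) = y := by
  rw [moveDown, if_neg h, moveUp, sub_add_cancel]

lemma moveDown_moveUp_of_le {i : Fin d} (hi : m ≤ (i : ℕ)) (j : Fin d) (y : Fin d → ℤ) :
    moveDown m j (moveUp i y) = moveUp i (moveDown m j y) := by
  rcases eq_or_ne j i with rfl | h
  · simp only [moveDown, moveUp, hi.not_gt, false_and, if_false]
    abel
  · exact moveDown_moveUp_of_ne h y

lemma moveUp_inj {i : Fin d} : moveUp i x = moveUp i y ↔ x = y := by
  simp [moveUp]

end Moves

section Count

variable {m d : ℕ} {x y : Fin d → ℤ}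

lemma moves_indicator_symm (hx : memU m x) (hy : memU m y) (j : Fin d) :
    ((if x = moveUp j y then 1 else 0) + (if x = moveDown m j y then 1 else 0) : ℝ≥0∞) =
      (if moveUp j x = y then 1 else 0) + (if moveDown m j x = y then 1 else 0) := by
  by_cases hbx : (j : ℕ) < m ∧ x j ≤ 0 <;> by_cases hby : (j : ℕ) < m ∧ y j ≤ 0
  · have h1 : x ≠ moveUp j y := by
      rintro rfl
      have := hy j hbx.1
      have := hbx.2
      simp [moveUp] at this
      omega
    have h2 : moveUp j x ≠ y := by
      rintro rfl
      have := hx j hbx.1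
      have := hby.2
      simp [moveUp] at this
      omega
    simp [moveDown_of_blocked hbx.1 hbx.2, moveDown_of_blocked hby.1 hby.2, h1, h2]
  · have h1 : x ≠ moveUp j y := by
      rintro rfl
      have := hy j hbx.1
      have := hbx.2
      simp [moveUp] at this
      omega
    have h2 : x ≠ y := by rintro rfl; exact hby hbx
    have h3 : x = moveDown m j y ↔ moveUp j x = y := by
      rw [← moveUp_inj (i := j), moveUp_moveDown_self hby]
    simp [moveDown_of_blocked hbx.1 hbx.2, h1, h2, h3]
  · have h1 : moveUp j x ≠ y := by
      rintro rfl
      have := hx j hby.1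
      have := hby.2
      simp [moveUp] at this
      omega
    have h2 : x ≠ y := by rintro rfl; exact hbx hby
    have h3 : moveDown m j x = y ↔ x = moveUp j y := by
      rw [← moveUp_inj (i := j), moveUp_moveDown_self hbx]
    simp [moveDown_of_blocked hby.1 hby.2, h1, h2, h3]
  · have h1 : x = moveDown m j y ↔ moveUp j x = y := by
      rw [← moveUp_inj (i := j), moveUp_moveDown_self hby]
    have h2 : moveDown m j x = y ↔ x = moveUp j y := by
      rw [← moveUp_inj (i := j), moveUp_moveDown_self hbx]
    simp only [h1, h2]
    rw [add_comm]

lemma lazyCount_succ_left (n : ℕ) (hx : memU m x) (hy : memU m y) :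
    lazyCount m (n + 1) x y =
      ∑ j, (lazyCount m n (moveUp j x) y + lazyCount m n (moveDown m j x) y) := by
  induction n generalizing y with
  | zero =>
    simp only [lazyCount]
    exact Finset.sum_congr rfl fun j _ => moves_indicator_symm hx hy j
  | succ n ih =>
    rw [lazyCount]
    simp only [ih (memU_moveUp hy _), ih (memU_moveDown hy _)]
    simp only [lazyCount, ← Finset.sum_add_distrib]
    rw [Finset.sum_comm]
    refine Finset.sum_congr rfl fun j _ => Finset.sum_congr rfl fun k _ => ?_
    ring

lemma lazyCount_symm (n : ℕ) (hx : memU m x) (hy : memU m y) :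
    lazyCount m n x y = lazyCount m n y x := by
  induction n generalizing y with
  | zero => simp [lazyCount, eq_comm]
  | succ n ih =>
    rw [lazyCount_succ_left n hy hx, lazyCount]
    exact Finset.sum_congr rfl fun j _ => by
      rw [ih (memU_moveUp hy j), ih (memU_moveDown hy j)]

lemma lazyCount_moveUp_right_le (n : ℕ) {i : Fin d} (hi : (i : ℕ) < m) (hxi : x i = 0)
    (hy : memU m y) : lazyCount m n x (moveUp i y) ≤ lazyCount m n x y := by
  induction n generalizing y with
  | zero =>
    have : x ≠ moveUp i y := by
      rintro rfl
      have := hy i hi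
      simp [moveUp] at hxi
      omega
    simp [lazyCount, this]
  | succ n ih =>
    rw [lazyCount, lazyCount]
    refine Finset.sum_le_sum fun j _ => add_le_add ?_ ?_
    · rw [moveUp_comm]
      exact ih (memU_moveUp hy j)
    · rcases eq_or_ne j i with rfl | h
      · rw [moveDown_moveUp_self hy]
        by_cases hb : y j ≤ 0
        · rw [moveDown_of_blocked hi hb]
        · conv_lhs => rw [← moveUp_moveDown_self (m := m) (i := j) (y := y) (by tauto)]
          exact ih (memU_moveDown hy j)
      · rw [moveDown_moveUp_of_ne h]
        exact ih (memU_moveDown hy j)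

lemma lazyCount_moveUp_le (n : ℕ) {i : Fin d} (hi : (i : ℕ) < m) (hx : memU m x)
    (hy : memU m y) : lazyCount m n (moveUp i x) (moveUp i y) ≤ lazyCount m n x y := by
  induction n generalizing y with
  | zero => simp [lazyCount, moveUp_inj]
  | succ n ih =>
    rw [lazyCount, lazyCount]
    refine Finset.sum_le_sum fun j _ => add_le_add ?_ ?_
    · rw [moveUp_comm]
      exact ih (memU_moveUp hy j)
    · rcases eq_or_ne j i with rfl | h
      · rw [moveDown_moveUp_self hy]
        by_cases hb : y j ≤ 0
        · rw [moveDown_of_blocked hi hb, lazyCount_symm n (memU_moveUp hx j) hy,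
            lazyCount_symm n hx hy]
          exact lazyCount_moveUp_right_le n hi (le_antisymm hb (hy j hi)) hx
        · conv_lhs => rw [← moveUp_moveDown_self (m := m) (i := j) (y := y) (by tauto)]
          exact ih (memU_moveDown hy j)
      · rw [moveDown_moveUp_of_ne h]
        exact ih (memU_moveDown hy j)

lemma lazyCount_moveUp_eq (n : ℕ) {i : Fin d} (hi : m ≤ (i : ℕ)) (x y : Fin d → ℤ) :
    lazyCount m n (moveUp i x) (moveUp i y) = lazyCount m n x y := by
  induction n generalizing y with
  | zero => simp [lazyCount, moveUp_inj]
  | succ n ih =>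
    rw [lazyCount, lazyCount]
    refine Finset.sum_congr rfl fun j _ => ?_
    rw [moveUp_comm, moveDown_moveUp_of_le hi, ih, ih]

lemma lazyCount_diag_le (n : ℕ) (hx : memU m x) :
    lazyCount m n x x ≤ lazyCount m n (0 : Fin d → ℤ) 0 := by
  induction hk : ∑ i, (x i).natAbs using Nat.strong_induction_on generalizing x with
  | _ k ih =>
    by_cases h0 : x = 0
    · rw [h0]
    obtain ⟨i, hi⟩ := Function.ne_iff.mp h0
    have key : ∀ z : Fin d → ℤ, (z i).natAbs < (x i).natAbs → (∀ j ≠ i, z j = x j) →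
        ∑ j, (z j).natAbs < k := by
      intro z hz hne
      rw [← hk]
      refine Finset.sum_lt_sum (fun j _ => ?_) ⟨i, Finset.mem_univ _, hz⟩
      rcases eq_or_ne j i with rfl | h
      · exact hz.le
      · rw [hne j h]
    rcases lt_or_gt_of_ne hi with hneg | hpos
    · have him : m ≤ (i : ℕ) := by
        by_contra hlt
        have := hx i (by omega)
        simp at hneg
        omega
      rw [← lazyCount_moveUp_eq n him]
      refine ih _ (key _ ?_ ?_) (memU_moveUp hx i) rfl
      · simp [moveUp] at hneg ⊢
        omega
      · intro j hj
        simp [moveUp, hj]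
    · have hb : ¬ ((i : ℕ) < m ∧ x i ≤ 0) := by
        simp at hpos
        omega
      have hlt : lazyCount m n (moveDown m i x) (moveDown m i x) ≤
          lazyCount m n (0 : Fin d → ℤ) 0 := by
        refine ih _ (key _ ?_ ?_) (memU_moveDown hx i) rfl
        · simp [moveDown, hb] at hpos ⊢
          omega
        · intro j hj
          simp [moveDown, hb, hj]
      refine le_trans ?_ hlt
      conv_lhs => rw [← moveUp_moveDown_self hb]
      rcases lt_or_ge (i : ℕ) m with him | him
      · exact lazyCount_moveUp_le n him (memU_moveDown hx i) (memU_moveDown hx i)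
      · exact (lazyCount_moveUp_eq n him _ _).le

lemma lazyGreen_diag_le (hx : memU m x) : lazyGreen m x x ≤ lazyGreen m (0 : Fin d → ℤ) 0 :=
  ENNReal.tsum_le_tsum fun n => mul_le_mul_right (lazyCount_diag_le n hx) _

end Count

section Neighbors

variable {m d : ℕ} {y z : Fin d → ℤ}

lemma latAdj_iff : latAdj z y ↔ ∃ j, z = y + Pi.single j 1 ∨ z = y - Pi.single j 1 := by
  constructor
  · intro h
    obtain ⟨j, hj⟩ : ∃ j, z j - y j ≠ 0 := by
      by_contra! hc
      simp [latAdj, hc] at h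
    have hsum : (z j - y j).natAbs + ∑ i ∈ Finset.univ.erase j, (z i - y i).natAbs = 1 := by
      rw [Finset.add_sum_erase _ (fun i => (z i - y i).natAbs) (Finset.mem_univ j)]
      exact h
    have hrest : ∑ i ∈ Finset.univ.erase j, (z i - y i).natAbs = 0 := by omega
    have hz : ∀ i ≠ j, z i = y i := by
      intro i hi
      have := Finset.sum_eq_zero_iff.mp hrest i (by simp [hi])
      omega
    refine ⟨j, ?_⟩
    rcases (by omega : z j = y j + 1 ∨ z j = y j - 1) with h1 | h1
    · left
      ext i
      rcases eq_or_ne i j with rfl | hi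
      · simp [h1]
      · simp [hi, hz i hi]
    · right
      ext i
      rcases eq_or_ne i j with rfl | hi
      · simp [h1]
      · simp [hi, hz i hi]
  · rintro ⟨j, rfl | rfl⟩ <;>
    simp [latAdj, Pi.single_apply, apply_ite Int.natAbs]

lemma cU_eq_sum (hy : memU m y) :
    cU d m z y = ∑ j, ((if z = moveUp j y then 1 else 0) +
      (if ¬ ((j : ℕ) < m ∧ y j ≤ 0) ∧ z = moveDown m j y then 1 else 0)) := by
  by_cases h : ∃ j, z = moveUp j y
  · obtain ⟨j, rfl⟩ := h
    have hc : memU m (moveUp j y) ∧ memU m y ∧ latAdj (moveUp j y) y :=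
      ⟨memU_moveUp hy j, hy, latAdj_iff.mpr ⟨j, Or.inl rfl⟩⟩
    have h1 : ∀ k, moveUp j y = moveUp k y ↔ k = j := by
      intro k
      constructor
      · intro h
        have := congrFun h j
        by_contra hk
        simp [moveUp, Ne.symm hk] at this
      · rintro rfl; rfl
    have h2 : ∀ k : Fin d, ¬ (¬ ((k : ℕ) < m ∧ y k ≤ 0) ∧ moveUp j y = moveDown m k y) := by
      rintro k ⟨hb, h⟩
      have := congrFun h j
      simp only [moveDown, if_neg hb, moveUp] at this
      rcases eq_or_ne j k with rfl | hjk
      · simp at this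
        omega
      · simp [hjk] at this
    simp only [cU, if_pos hc, h1, if_neg (h2 _)]
    simp
  by_cases h' : ∃ j : Fin d, ¬ ((j : ℕ) < m ∧ y j ≤ 0) ∧ z = moveDown m j y
  · obtain ⟨j, hb, rfl⟩ := h'
    have hc : memU m (moveDown m j y) ∧ memU m y ∧ latAdj (moveDown m j y) y :=
      ⟨memU_moveDown hy j, hy, latAdj_iff.mpr ⟨j, Or.inr (if_neg hb)⟩⟩
    have h2 : ∀ k : Fin d, (¬ ((k : ℕ) < m ∧ y k ≤ 0) ∧ moveDown m j y = moveDown m k y) ↔ k = j := by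
      intro k
      constructor
      · rintro ⟨hk, h⟩
        simp only [moveDown, if_neg hb, if_neg hk] at h
        have := congrFun h j
        by_contra hk
        simp [Ne.symm hk] at this
      · rintro rfl
        exact ⟨hb, rfl⟩
    push Not at h
    simp only [cU, if_pos hc, h2, if_neg (h _)]
    simp
  · have hc : ¬ (memU m z ∧ memU m y ∧ latAdj z y) := by
      rintro ⟨hz, -, ha⟩
      obtain ⟨j, hj | hj⟩ := latAdj_iff.mp ha
      · exact h ⟨j, hj⟩
      · have hb : ¬ ((j : ℕ) < m ∧ y j ≤ 0) := by
          rintro ⟨hjm, hle⟩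
          have := hz j hjm
          simp [hj] at this
          omega
        exact h' ⟨j, hb, by rw [moveDown, if_neg hb, hj]⟩
    push Not at h
    rw [not_exists] at h'
    simp only [cU, if_neg hc, if_neg (h _), if_neg (h' _)]
    simp

lemma tsum_mul_cU_add_blocked (hy : memU m y) (h : (Fin d → ℤ) → ℝ≥0∞) :
    ∑' z, h z * cU d m z y + blockedCount m y * h y =
      ∑ j, (h (moveUp j y) + h (moveDown m j y)) := by
  simp only [cU_eq_sum hy, Finset.mul_sum]
  rw [Summable.tsum_finsetSum fun _ _ => ENNReal.summable, blockedCount, Finset.sum_mul,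
    ← Finset.sum_add_distrib]
  refine Finset.sum_congr rfl fun j _ => ?_
  simp only [mul_add]
  rw [ENNReal.tsum_add]
  by_cases hb : (j : ℕ) < m ∧ y j ≤ 0
  · simp [hb, moveDown_of_blocked hb.1 hb.2, tsum_ite_eq]
  · simp [hb, tsum_ite_eq]

lemma cU_symm (x y : Fin d → ℤ) : cU d m x y = cU d m y x := by
  have : latAdj x y ↔ latAdj y x := by
    unfold latAdj
    have (i : Fin d) : (x i - y i).natAbs = (y i - x i).natAbs := by omega
    simp only [this]
  simp only [cU, this]
  congr 1
  apply propext
  tauto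

lemma piW_cU_add_blocked (hy : memU m y) : piW (cU d m) y + blockedCount m y = 2 * d := by
  have := tsum_mul_cU_add_blocked hy (fun _ => 1)
  simp only [one_mul, mul_one] at this
  simp only [piW, fun z => cU_symm (m := m) y z, this]
  simp
  ring

lemma piW_cU_ne_zero (hd : 0 < d) (hy : memU m y) : piW (cU d m) y ≠ 0 := by
  have hc : cU d m y (moveUp ⟨0, hd⟩ y) = 1 := by
    rw [cU_symm]
    exact if_pos ⟨memU_moveUp hy _, hy, latAdj_iff.mpr ⟨_, Or.inl rfl⟩⟩
  have : 1 ≤ piW (cU d m) y := hc ▸ ENNReal.le_tsum _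
  exact (zero_lt_one.trans_le this).ne'

lemma piW_cU_ne_top (hy : memU m y) : piW (cU d m) y ≠ ⊤ := by
  have h := piW_cU_add_blocked hy
  intro ht
  rw [ht, top_add] at h
  exact ENNReal.mul_ne_top (by simp) (by simp) h.symm

end Neighbors

section Green

variable [DecidableEq V] {c : V → V → ℝ≥0∞}

lemma tsum_stepN_eq (c : V → V → ℝ≥0∞) (x y : V) :
    ∑' n, stepN c n x y =
      (if x = y then 1 else 0) + ∑' z, (∑' n, stepN c n x z) * step c z y := by
  rw [tsum_eq_zero_add' ENNReal.summable]
  simp only [stepN, ← ENNReal.tsum_mul_right]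
  rw [ENNReal.tsum_comm]

lemma sum_stepN_le {x : V} {h : V → ℝ≥0∞}
    (hsup : ∀ y, (if x = y then 1 else 0) + ∑' z, h z * c z y ≤ piW c y * h y) (N : ℕ) (y : V) :
    ∑ n ∈ Finset.range N, stepN c n x y ≤ piW c y * h y := by
  induction N generalizing y with
  | zero => simp
  | succ N ih =>
    rw [Finset.sum_range_succ']
    simp only [stepN]
    rw [← Summable.tsum_finsetSum fun _ _ => ENNReal.summable, add_comm]
    refine le_trans (add_le_add le_rfl (ENNReal.tsum_le_tsum fun z => ?_)) (hsup y)
    rw [← Finset.sum_mul]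
    calc (∑ n ∈ Finset.range N, stepN c n x z) * step c z y
        ≤ (piW c z * h z) * step c z y := by gcongr; exact ih z
      _ = (piW c z * (piW c z)⁻¹) * (h z * c z y) := by
          rw [step, div_eq_mul_inv]; ring
      _ ≤ 1 * (h z * c z y) := by gcongr; exact ENNReal.mul_inv_le_one _
      _ = h z * c z y := one_mul _

/-- Green's function is dominated by every nonnegative supersolution. -/
lemma green_le_of_supersolution {x : V} {h : V → ℝ≥0∞}
    (hsup : ∀ y, (if x = y then 1 else 0) + ∑' z, h z * c z y ≤ piW c y * h y) (y : V) :
    green c x y ≤ h y := by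
  have hle : ∑' n, stepN c n x y ≤ piW c y * h y :=
    ENNReal.tsum_le_of_sum_range_le fun N => sum_stepN_le hsup N y
  calc green c x y ≤ (piW c y)⁻¹ * (piW c y * h y) := by unfold green; gcongr
    _ = (piW c y)⁻¹ * piW c y * h y := by ring
    _ ≤ 1 * h y := by gcongr; exact ENNReal.inv_mul_le_one _
    _ = h y := one_mul _

lemma piW_mul_green {x y : V} (h0 : piW c y ≠ 0) (ht : piW c y ≠ ⊤) :
    piW c y * green c x y = (if x = y then 1 else 0) + ∑' z, green c x z * c z y := by
  rw [green, ← mul_assoc, ENNReal.mul_inv_cancel h0 ht, one_mul, tsum_stepN_eq]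
  congr 1
  refine tsum_congr fun z => ?_
  rw [green, step, div_eq_mul_inv]
  ring

end Green

section Comparison

variable {m d : ℕ} {x y : Fin d → ℤ}

lemma two_mul_natCast_ne_zero (hd : 0 < d) : (2 * d : ℝ≥0∞) ≠ 0 := by
  simp; omega

lemma two_mul_natCast_ne_top : (2 * d : ℝ≥0∞) ≠ ⊤ := ENNReal.mul_ne_top (by simp) (by simp)

lemma two_mul_lazyGreen (hd : 0 < d) (x y : Fin d → ℤ) :
    2 * d * lazyGreen m x y = (if x = y then 1 else 0) +
      ∑ j, (lazyGreen m x (moveUp j y) + lazyGreen m x (moveDown m j y)) := by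
  have hinv : (2 * d : ℝ≥0∞) * (2 * d : ℝ≥0∞)⁻¹ = 1 :=
    ENNReal.mul_inv_cancel (two_mul_natCast_ne_zero hd) two_mul_natCast_ne_top
  simp only [lazyGreen]
  rw [← ENNReal.tsum_mul_left, tsum_eq_zero_add' ENNReal.summable]
  congr 1
  · rw [← mul_assoc, zero_add, pow_one, hinv, one_mul, lazyCount]
  · simp only [← ENNReal.tsum_add]
    rw [← Summable.tsum_finsetSum fun _ _ => ENNReal.summable]
    refine tsum_congr fun n => ?_
    rw [← mul_assoc, pow_succ', ← mul_assoc, hinv, one_mul, lazyCount, Finset.mul_sum]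
    simp only [mul_add]

lemma Gm_le_lazyGreen (hd : 0 < d) (hx : memU m x) (y : Fin d → ℤ) :
    Gm d m x y ≤ lazyGreen m x y := by
  refine green_le_of_supersolution (fun y => ?_) y
  by_cases hy : memU m y
  · by_cases ht : lazyGreen m x y = ⊤
    · rw [ht, ENNReal.mul_top (piW_cU_ne_zero hd hy)]
      exact le_top
    have hB : blockedCount m y ≠ ⊤ := by
      have h := piW_cU_add_blocked hy
      intro hb
      rw [hb, add_top] at h
      exact two_mul_natCast_ne_top h.symm
    refine (ENNReal.add_le_add_iff_right (ENNReal.mul_ne_top hB ht)).mp (le_of_eq ?_)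
    rw [← add_mul, piW_cU_add_blocked hy, two_mul_lazyGreen hd, add_assoc,
      tsum_mul_cU_add_blocked hy]
  · have hne : x ≠ y := by rintro rfl; exact hy hx
    simp [hne, cU, hy]

lemma lazyGreen_le_Gm (hd : 0 < d) (x : Fin d → ℤ) (hy : memU m y) :
    lazyGreen m x y ≤ Gm d m x y := by
  have heq : ∀ y, memU m y → (if x = y then 1 else 0) +
      ∑ j, (Gm d m x (moveUp j y) + Gm d m x (moveDown m j y)) = 2 * d * Gm d m x y := by
    intro y hy
    rw [← tsum_mul_cU_add_blocked hy, ← add_assoc, ← piW_cU_add_blocked hy, add_mul, Gm,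
      piW_mul_green (piW_cU_ne_zero hd hy) (piW_cU_ne_top hy)]
  refine ENNReal.tsum_le_of_sum_range_le fun N => ?_
  induction N generalizing y with
  | zero => simp
  | succ N ih =>
    have hinv : (2 * d : ℝ≥0∞)⁻¹ * (2 * d : ℝ≥0∞) = 1 :=
      ENNReal.inv_mul_cancel (two_mul_natCast_ne_zero hd) two_mul_natCast_ne_top
    calc ∑ n ∈ Finset.range (N + 1), ((2 * d : ℝ≥0∞)⁻¹) ^ (n + 1) * lazyCount m n x y
        = (2 * d : ℝ≥0∞)⁻¹ * ((if x = y then 1 else 0) + ∑ j,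
            (∑ n ∈ Finset.range N, ((2 * d : ℝ≥0∞)⁻¹) ^ (n + 1) * lazyCount m n x (moveUp j y) +
             ∑ n ∈ Finset.range N,
              ((2 * d : ℝ≥0∞)⁻¹) ^ (n + 1) * lazyCount m n x (moveDown m j y))) := by
          rw [Finset.sum_range_succ', add_comm, mul_add, zero_add, pow_one]
          congr 1
          simp only [← Finset.sum_add_distrib]
          rw [Finset.sum_comm, Finset.mul_sum]
          refine Finset.sum_congr rfl fun n _ => ?_
          simp only [← mul_add]
          rw [lazyCount, ← Finset.mul_sum, ← mul_assoc, ← pow_succ']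
      _ ≤ (2 * d : ℝ≥0∞)⁻¹ * ((if x = y then 1 else 0) +
            ∑ j, (Gm d m x (moveUp j y) + Gm d m x (moveDown m j y))) := by
          gcongr with j
          · exact ih (memU_moveUp hy j)
          · exact ih (memU_moveDown hy j)
      _ = Gm d m x y := by rw [heq y hy, ← mul_assoc, hinv, one_mul]

end Comparison

/-- For `d ≥ 3` and `0 ≤ m ≤ d`, the diagonal of the Green's function on
`U_m = ℕ₀^m × ℤ^{d-m}` attains its supremum at the origin:
`sup_{x ∈ U_m} G_m(x,x) = G_m(0,0)`. -/
theorem green_Um_sup_diag (d : ℕ) (hd : 3 ≤ d) (m : ℕ) (hm : m ≤ d) :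
    (⨆ (x : Fin d → ℤ) (_ : memU m x), Gm d m x x) = Gm d m 0 0 := by
  have hd0 : 0 < d := by omega
  have h0 : memU m (0 : Fin d → ℤ) := fun _ _ => le_rfl
  refine le_antisymm (iSup₂_le fun x hx => ?_) (le_iSup₂ (f := fun x _ => Gm d m x x) 0 h0)
  exact (Gm_le_lazyGreen hd0 hx x).trans ((lazyGreen_diag_le hx).trans (lazyGreen_le_Gm hd0 0 h0))

end
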